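/- Let D be the six-sided die with faces {1,1,4,4,5,6} and G the six-sided die with faces {0,1,2,6,6,6}. For every integer n with 1 ≤ n ≤ 58116 and n ≠ 4, G[n] beats D[n], and for n = 4, D[4] beats G[4]. -/

import Mathlib

-- The probability of an event `p` under the uniform distribution on a finite
-- sample space `Ω`, as a rational number.
open Classical in
noncomputable def prob {Ω : Type*} [Fintype Ω] (p : Ω → Prop) : ℚ :=
  ((Finset.univ.filter p).card : ℚ) / (Fintype.card Ω : ℚ)

/-- The sum of the face values of a die `D` (a function from a finite index type
of faces to values) along a sequence of `k` rolls `f`. -/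
def sumRolls {ι : Type*} (D : ι → ℤ) {k : ℕ} (f : Fin k → ι) : ℤ :=
  ∑ i, D (f i)

/-- `Beats A B k` : after summing `k` independent uniform rolls of each die,
`A` is strictly more likely to show the larger total than `B`. -/
def Beats {ι κ : Type*} [Fintype ι] [Fintype κ] (A : ι → ℤ) (B : κ → ℤ) (k : ℕ) : Prop :=
  prob (fun p : (Fin k → ι) × (Fin k → κ) => sumRolls B p.2 < sumRolls A p.1) >
    prob (fun p : (Fin k → ι) × (Fin k → κ) => sumRolls A p.1 < sumRolls B p.2)

/-- The die David, with faces {1,1,4,4,5,6}. -/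
def David : Fin 6 → ℤ := ![1, 1, 4, 4, 5, 6]

/-- The die Goliath, with faces {0,1,2,6,6,6}. -/
def Goliath : Fin 6 → ℤ := ![0, 1, 2, 6, 6, 6]

open Finset

/-- The amount by which Goliath's total exceeds David's. -/
def margin {n : ℕ} (p : (Fin n → Fin 6) × (Fin n → Fin 6)) : ℤ :=
  sumRolls Goliath p.1 - sumRolls David p.2

lemma beats_iff_card {ι κ : Type*} [Fintype ι] [Fintype κ] [Nonempty ι] [Nonempty κ]
    (A : ι → ℤ) (B : κ → ℤ) (k : ℕ) :
    Beats A B k ↔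
      #{p : (Fin k → ι) × (Fin k → κ) | sumRolls A p.1 < sumRolls B p.2} <
        #{p : (Fin k → ι) × (Fin k → κ) | sumRolls B p.2 < sumRolls A p.1} := by
  have h : (0 : ℚ) < Fintype.card ((Fin k → ι) × (Fin k → κ)) := by
    exact_mod_cast Fintype.card_pos
  unfold Beats prob
  rw [gt_iff_lt, div_lt_div_iff_of_pos_right h, Nat.cast_lt]
  constructor <;> intro h <;> convert h

lemma goliath_beats_david_iff (n : ℕ) :
    Beats Goliath David n ↔
      #{p : (Fin n → Fin 6) × (Fin n → Fin 6) | margin p < 0} <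
        #{p : (Fin n → Fin 6) × (Fin n → Fin 6) | 0 < margin p} := by
  simp only [beats_iff_card, margin, sub_neg, sub_pos]

lemma david_beats_goliath_of_card {n : ℕ}
    (h : #{p : (Fin n → Fin 6) × (Fin n → Fin 6) | 0 < margin p} <
      #{p : (Fin n → Fin 6) × (Fin n → Fin 6) | margin p < 0}) :
    Beats David Goliath n := by
  rw [beats_iff_card]
  simp only [margin, sub_neg, sub_pos] at h
  convert h using 1
  · exact card_equiv (Equiv.prodComm _ _) (by simp)
  · exact card_equiv (Equiv.prodComm _ _) (by simp)

lemma sum_prod_pairs {ι κ R : Type*} [Fintype ι] [Fintype κ] [CommSemiring R]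
    (w : ι → κ → R) (n : ℕ) :
    ∑ p : (Fin n → ι) × (Fin n → κ), ∏ i, w (p.1 i) (p.2 i) = (∑ i, ∑ j, w i j) ^ n := by
  rw [← Fintype.sum_prod_type', Fintype.sum_pow]
  exact (Equiv.sum_comp (Equiv.arrowProdEquivProdArrow (Fin n) (fun _ => ι) (fun _ => κ)).symm
    (fun f : Fin n → ι × κ => ∏ i, w (f i).1 (f i).2)).symm ▸ rfl

/-! ### Small numbers of rolls -/

section BaseExpansion

variable {Ω : Type*} [Fintype Ω] (e : Ω → ℕ) {x : ℕ}

lemma sum_filter_pow_lt_pow (hx : Fintype.card Ω < x) (m : ℕ) :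
    ∑ p with e p < m, x ^ e p < x ^ m := by
  have hx0 : 0 < x := by omega
  rcases m with _ | m
  · simp
  calc ∑ p with e p < m + 1, x ^ e p ≤ ∑ p with e p < m + 1, x ^ m :=
        sum_le_sum fun p hp => Nat.pow_le_pow_right hx0 (by simpa [Nat.lt_succ_iff] using hp)
    _ = #{p | e p < m + 1} * x ^ m := by simp
    _ ≤ Fintype.card Ω * x ^ m := Nat.mul_le_mul_right _ (card_le_univ _)
    _ < x * x ^ m := Nat.mul_lt_mul_of_pos_right hx (by positivity)
    _ = x ^ (m + 1) := by ring

lemma sum_pow_eq_add_mul (m : ℕ) :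
    ∑ p, x ^ e p = ∑ p with e p < m, x ^ e p + x ^ m * ∑ p with m ≤ e p, x ^ (e p - m) := by
  rw [← sum_filter_add_sum_filter_not univ (fun p => e p < m), mul_sum]
  congr 1
  refine sum_congr (by ext; simp) fun p hp => ?_
  rw [← pow_add, Nat.add_sub_cancel' (by simpa using hp)]

lemma sum_pow_mod_pred (hx : Fintype.card Ω + 1 < x) (s : Finset Ω) (f : Ω → ℕ) :
    (∑ p ∈ s, x ^ f p) % (x - 1) = #s := by
  have h1 : ∑ p ∈ s, x ^ f p ≡ #s [MOD x - 1] := by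
    rw [card_eq_sum_ones]
    refine Nat.ModEq.sum fun p _ => ?_
    have h : x ≡ 1 [MOD x - 1] := ((Nat.modEq_iff_dvd' (by omega)).2 dvd_rfl).symm
    simpa using h.pow (f p)
  rw [h1, Nat.mod_eq_of_lt]
  have := card_le_univ s
  omega

lemma sum_pow_div_mod (hx : Fintype.card Ω + 1 < x) (m : ℕ) :
    (∑ p, x ^ e p) / x ^ m % (x - 1) = #{p | m ≤ e p} := by
  rw [sum_pow_eq_add_mul e m, Nat.add_mul_div_left _ _ (pow_pos (by omega) m),
    Nat.div_eq_of_lt (sum_filter_pow_lt_pow e (by omega) m), zero_add, sum_pow_mod_pred hx]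

lemma sum_pow_mod_mod (hx : Fintype.card Ω + 1 < x) (m : ℕ) :
    (∑ p, x ^ e p) % x ^ m % (x - 1) = #{p | e p < m} := by
  rw [sum_pow_eq_add_mul e m, Nat.add_mul_mod_self_left,
    Nat.mod_eq_of_lt (sum_filter_pow_lt_pow e (by omega) m), sum_pow_mod_pred hx]

end BaseExpansion

/-- The generating polynomial of one round, with exponents shifted by `6`. -/
def roundPoly (x : ℕ) : ℕ :=
  1 + 2 * x + 4 * x ^ 2 + 3 * x ^ 3 + 2 * x ^ 4 + 2 * x ^ 5 + 5 * x ^ 6 + 5 * x ^ 7 + 6 * x ^ 8 +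
    6 * x ^ 11

/-- The sum over all rounds of the margin shifted by `6`. -/
def shiftedMargin {n : ℕ} (p : (Fin n → Fin 6) × (Fin n → Fin 6)) : ℕ :=
  ∑ i, (6 + Goliath (p.1 i) - David (p.2 i)).toNat

lemma shiftedMargin_eq {n : ℕ} (p : (Fin n → Fin 6) × (Fin n → Fin 6)) :
    (shiftedMargin p : ℤ) = 6 * n + margin p := by
  have h : ∀ i j, 0 ≤ 6 + Goliath i - David j := by decide
  simp [shiftedMargin, margin, sumRolls, add_sub_assoc, ← sum_sub_distrib]
  rw [sum_congr rfl fun i _ => max_eq_left (by simpa [add_sub_assoc] using h (p.1 i) (p.2 i))]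
  simp [sum_add_distrib, mul_comm]

lemma sum_pow_shiftedMargin (n x : ℕ) :
    ∑ p : (Fin n → Fin 6) × (Fin n → Fin 6), x ^ shiftedMargin p = roundPoly x ^ n := by
  simp only [shiftedMargin, ← prod_pow_eq_pow_sum]
  rw [sum_prod_pairs fun i j => x ^ (6 + Goliath i - David j).toNat]
  congr 1
  simp [Fin.sum_univ_succ, Goliath, David, roundPoly]
  ring

lemma card_lt_two_pow {n : ℕ} (hn : n < 32) :
    Fintype.card ((Fin n → Fin 6) × (Fin n → Fin 6)) + 1 < 2 ^ 170 := by
  have h : 6 ^ n ≤ 6 ^ 31 := Nat.pow_le_pow_right (by norm_num) (by omega)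
  simp only [Fintype.card_prod, Fintype.card_fun, Fintype.card_fin]
  calc 6 ^ n * 6 ^ n + 1 ≤ 6 ^ 31 * 6 ^ 31 + 1 := by gcongr
    _ < 2 ^ 170 := by norm_num

lemma card_margin_pos {n : ℕ} (hn : n < 32) :
    #{p : (Fin n → Fin 6) × (Fin n → Fin 6) | 0 < margin p} =
      roundPoly (2 ^ 170) ^ n / (2 ^ 170) ^ (6 * n + 1) % (2 ^ 170 - 1) := by
  rw [← sum_pow_shiftedMargin, sum_pow_div_mod _ (card_lt_two_pow hn)]
  congr 1
  ext p
  have := shiftedMargin_eq p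
  simp only [mem_filter, mem_univ, true_and]
  omega

lemma card_margin_neg {n : ℕ} (hn : n < 32) :
    #{p : (Fin n → Fin 6) × (Fin n → Fin 6) | margin p < 0} =
      roundPoly (2 ^ 170) ^ n % (2 ^ 170) ^ (6 * n) % (2 ^ 170 - 1) := by
  rw [← sum_pow_shiftedMargin, sum_pow_mod_mod _ (card_lt_two_pow hn)]
  congr 1
  ext p
  have := shiftedMargin_eq p
  simp only [mem_filter, mem_univ, true_and]
  omega

lemma roundPoly_digits_lt : ∀ n < 32, 1 ≤ n → n ≠ 4 →
    roundPoly (2 ^ 170) ^ n % (2 ^ 170) ^ (6 * n) % (2 ^ 170 - 1) <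
      roundPoly (2 ^ 170) ^ n / (2 ^ 170) ^ (6 * n + 1) % (2 ^ 170 - 1) := by
  decide +kernel

lemma goliath_beats_david_of_lt {n : ℕ} (h1 : 1 ≤ n) (h4 : n ≠ 4) (hn : n < 32) :
    Beats Goliath David n := by
  rw [goliath_beats_david_iff, card_margin_pos hn, card_margin_neg hn]
  exact roundPoly_digits_lt n hn h1 h4

lemma david_beats_goliath_four : Beats David Goliath 4 := by
  apply david_beats_goliath_of_card
  rw [card_margin_pos (by norm_num), card_margin_neg (by norm_num)]
  decide +kernel

/-! ### A Fourier integral for the advantage -/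

/-- A trigonometric polynomial agreeing with `sin (k t) * cot (t / 2)` away from the zeros
of `1 - cos t`. -/
noncomputable def cosSum (k : ℕ) (t : ℝ) : ℝ :=
  ∑ j ∈ range k, (Real.cos (j * t) + Real.cos ((j + 1) * t))

@[fun_prop]
lemma continuous_cosSum (k : ℕ) : Continuous (cosSum k) := by
  unfold cosSum
  fun_prop

lemma cosSum_mul_one_sub_cos (k : ℕ) (t : ℝ) :
    cosSum k t * (1 - Real.cos t) = Real.sin (k * t) * Real.sin t := by
  induction k with
  | zero => simp [cosSum]
  | succ k ih =>
    have h : cosSum (k + 1) t = cosSum k t + (Real.cos (k * t) + Real.cos ((k + 1) * t)) := by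
      simp [cosSum, sum_range_succ]
    rw [h, add_mul, ih, Nat.cast_succ, add_one_mul (k : ℝ) t, Real.cos_add, Real.sin_add]
    linear_combination Real.cos (k * t) * (-Real.sin_sq_add_cos_sq t)

lemma integral_cos_nat_mul (k : ℕ) :
    ∫ t in (0 : ℝ)..Real.pi, Real.cos (k * t) = if k = 0 then Real.pi else 0 := by
  split_ifs with h
  · simp [h]
  · rw [intervalIntegral.integral_comp_mul_left _ (by exact_mod_cast h)]
    simp [integral_cos]

lemma integral_cosSum (k : ℕ) :
    ∫ t in (0 : ℝ)..Real.pi, cosSum k t = if k = 0 then 0 else Real.pi := by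
  have hc : ∀ j : ℕ, IntervalIntegrable (fun t : ℝ => Real.cos (j * t)) MeasureTheory.volume
      0 Real.pi := fun j => (by fun_prop : Continuous _).intervalIntegrable _ _
  unfold cosSum
  simp only [← Nat.cast_succ]
  rw [intervalIntegral.integral_finsetSum fun j _ => (hc j).add (hc (j + 1))]
  simp_rw [intervalIntegral.integral_add (hc _) (hc _), integral_cos_nat_mul]
  simp [Nat.pos_iff_ne_zero]

/-- The odd extension of `cosSum` to integer frequencies. -/
noncomputable def signKernel (k : ℤ) (t : ℝ) : ℝ := k.sign * cosSum k.natAbs t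

@[fun_prop]
lemma continuous_signKernel (k : ℤ) : Continuous (signKernel k) := by
  unfold signKernel
  fun_prop

lemma signKernel_mul_one_sub_cos (k : ℤ) (t : ℝ) :
    signKernel k t * (1 - Real.cos t) = Real.sin (k * t) * Real.sin t := by
  rw [signKernel, mul_assoc, cosSum_mul_one_sub_cos, ← mul_assoc]
  congr 1
  rcases lt_trichotomy k 0 with h | rfl | h
  · rw [Nat.cast_natAbs, abs_of_neg h, Int.sign_eq_neg_one_of_neg h]
    simp
  · simp
  · rw [Nat.cast_natAbs, abs_of_pos h, Int.sign_eq_one_of_pos h]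
    simp

lemma integral_signKernel (k : ℤ) :
    ∫ t in (0 : ℝ)..Real.pi, signKernel k t = Real.pi * k.sign := by
  unfold signKernel
  rw [intervalIntegral.integral_const_mul, integral_cosSum]
  rcases eq_or_ne k 0 with rfl | h
  · simp
  · simp [h, mul_comm]

/-- The integrand whose integral measures Goliath's advantage over `n` rounds. -/
noncomputable def advantage (n : ℕ) (t : ℝ) : ℝ :=
  ∑ p : (Fin n → Fin 6) × (Fin n → Fin 6), signKernel (margin p) t

@[fun_prop]
lemma continuous_advantage (n : ℕ) : Continuous (advantage n) := by
  unfold advantage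
  fun_prop

lemma integral_advantage (n : ℕ) :
    ∫ t in (0 : ℝ)..Real.pi, advantage n t =
      Real.pi * (#{p : (Fin n → Fin 6) × (Fin n → Fin 6) | 0 < margin p} -
        #{p : (Fin n → Fin 6) × (Fin n → Fin 6) | margin p < 0}) := by
  unfold advantage
  rw [intervalIntegral.integral_finsetSum fun p _ =>
    (continuous_signKernel _).intervalIntegrable _ _]
  simp_rw [integral_signKernel]
  rw [← mul_sum, card_filter, card_filter]
  push_cast
  rw [← sum_sub_distrib]
  congr 1
  refine sum_congr rfl fun p _ => ?_
  rcases lt_trichotomy (margin p) 0 with h | h | h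
  · simp [h, h.not_gt, Int.sign_eq_neg_one_of_neg]
  · simp [h]
  · simp [h, h.not_gt, Int.sign_eq_one_of_pos]

/-- The real part of the characteristic function of one round, in terms of `u = 1 - cos t`. -/
noncomputable def rePoly (u : ℝ) : ℝ :=
  (36 - 366 * u + 1222 * u ^ 2 - 1708 * u ^ 3 + 1104 * u ^ 4 - 320 * u ^ 5 + 32 * u ^ 6) / 36

/-- The imaginary part of the characteristic function of one round, divided by `u * sin t`
where `u = 1 - cos t`. -/
noncomputable def imPoly (u : ℝ) : ℝ :=
  (6 + 4 * u + 64 * u ^ 2 - 96 * u ^ 3 + 32 * u ^ 4) / 36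

/-- The characteristic function of one round. -/
noncomputable def roundCharFun (t : ℝ) : ℂ :=
  ⟨rePoly (1 - Real.cos t), Real.sin t * (1 - Real.cos t) * imPoly (1 - Real.cos t)⟩

lemma sum_cexp_faces (t : ℝ) :
    ∑ i, ∑ j, Complex.exp (((Goliath i - David j : ℤ) : ℂ) * (t * Complex.I)) =
      36 * roundCharFun t := by
  obtain ⟨w, hw⟩ : ∃ w : ℂ, w = ⟨Real.cos t, Real.sin t⟩ := ⟨_, rfl⟩
  have hw1 : Complex.exp (t * Complex.I) = w := by
    rw [Complex.exp_mul_I, hw]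
    apply Complex.ext <;> simp [← Complex.ofReal_cos, ← Complex.ofReal_sin]
  obtain ⟨v, hv⟩ : ∃ v : ℂ, v = ⟨Real.cos t, -Real.sin t⟩ := ⟨_, rfl⟩
  have hv1 : Complex.exp (-(t * Complex.I)) = v := by
    rw [← neg_mul, Complex.exp_mul_I, hv]
    apply Complex.ext <;> simp [← Complex.ofReal_cos, ← Complex.ofReal_sin]
  have hz : ∀ k : ℤ, Complex.exp ((k : ℂ) * (t * Complex.I)) =
      if 0 ≤ k then w ^ k.toNat else v ^ (-k).toNat := fun k => by
    split_ifs with h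
    · lift k to ℕ using h
      rw [← hw1, ← Complex.exp_nat_mul]
      simp
    · obtain ⟨m, rfl⟩ : ∃ m : ℕ, k = -m := ⟨k.natAbs, by omega⟩
      rw [← hv1, ← Complex.exp_nat_mul]
      simp
  simp only [hz, Fin.sum_univ_succ, Goliath, David]
  simp [-Int.reduceNeg]
  have s2 := Real.sin_sq t
  have s3 : Real.sin t ^ 3 = Real.sin t * (1 - Real.cos t ^ 2) := by rw [← s2]; ring
  have s4 : Real.sin t ^ 4 = (1 - Real.cos t ^ 2) ^ 2 := by rw [← s2]; ring
  have s5 : Real.sin t ^ 5 = Real.sin t * (1 - Real.cos t ^ 2) ^ 2 := by rw [← s2]; ring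
  have s6 : Real.sin t ^ 6 = (1 - Real.cos t ^ 2) ^ 3 := by rw [← s2]; ring
  apply Complex.ext
  · simp [pow_succ, hw, hv, roundCharFun, rePoly]
    ring_nf
    simp only [s2, s4, s6]
    ring
  · simp [pow_succ, hw, hv, roundCharFun, imPoly]
    ring_nf
    simp only [s3, s5]
    ring

lemma sum_cexp_margin (n : ℕ) (t : ℝ) :
    ∑ p : (Fin n → Fin 6) × (Fin n → Fin 6), Complex.exp ((margin p : ℂ) * (t * Complex.I)) =
      (36 * roundCharFun t) ^ n := by
  rw [← sum_cexp_faces, ← sum_prod_pairs]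
  refine sum_congr rfl fun p _ => ?_
  rw [← Complex.exp_sum, ← sum_mul]
  simp [margin, sumRolls]

lemma advantage_mul_one_sub_cos (n : ℕ) (t : ℝ) :
    advantage n t * (1 - Real.cos t) = 36 ^ n * (Real.sin t * (roundCharFun t ^ n).im) := by
  have h := congrArg Complex.im (sum_cexp_margin n t)
  rw [mul_pow, Complex.im_sum] at h
  have h36 : ((36 : ℂ) ^ n * roundCharFun t ^ n).im = 36 ^ n * (roundCharFun t ^ n).im := by
    rw [← Complex.im_ofReal_mul]
    norm_num
  rw [h36] at h
  rw [advantage, sum_mul, mul_left_comm, ← h, mul_sum]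
  refine sum_congr rfl fun p _ => ?_
  rw [signKernel_mul_one_sub_cos, mul_comm, ← mul_assoc, ← Complex.ofReal_intCast,
    ← Complex.ofReal_mul, Complex.exp_ofReal_mul_I_im]

/-! ### Estimates for the characteristic function -/

section PowerEstimates

variable (z : ℂ)

lemma abs_im_pow_succ_le (m : ℕ) :
    |(z ^ (m + 1)).im| ≤ (m + 1) * |z.im| * ‖z‖ ^ m := by
  induction m with
  | zero => simp
  | succ m ih =>
    have h1 : (z ^ (m + 2)).im = (z ^ (m + 1)).re * z.im + (z ^ (m + 1)).im * z.re := by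
      rw [pow_succ, Complex.mul_im]
    have h2 : |(z ^ (m + 1)).re| ≤ ‖z‖ ^ (m + 1) := by
      simpa using Complex.abs_re_le_norm (z ^ (m + 1))
    calc |(z ^ (m + 2)).im| ≤ |(z ^ (m + 1)).re| * |z.im| + |(z ^ (m + 1)).im| * |z.re| := by
          rw [h1, ← abs_mul, ← abs_mul]
          exact abs_add_le _ _
      _ ≤ ‖z‖ ^ (m + 1) * |z.im| + (m + 1) * |z.im| * ‖z‖ ^ m * ‖z‖ := by
          gcongr
          exact Complex.abs_re_le_norm z
      _ = ((m + 1 : ℕ) + 1) * |z.im| * ‖z‖ ^ (m + 1) := by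
          push_cast
          ring

lemma abs_re_pow_sub_le (m : ℕ) :
    |(z ^ (m + 2)).re - z.re ^ (m + 2)| ≤ (m + 2).choose 2 * |z.im| ^ 2 * ‖z‖ ^ m := by
  induction m with
  | zero => simp [pow_two]
  | succ m ih =>
    have h1 : (z ^ (m + 3)).re - z.re ^ (m + 3) =
        ((z ^ (m + 2)).re - z.re ^ (m + 2)) * z.re - (z ^ (m + 2)).im * z.im := by
      rw [pow_succ, Complex.mul_re]
      ring
    calc |(z ^ (m + 3)).re - z.re ^ (m + 3)|
        ≤ |(z ^ (m + 2)).re - z.re ^ (m + 2)| * |z.re| + |(z ^ (m + 2)).im| * |z.im| := by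
          rw [h1, ← abs_mul, ← abs_mul]
          exact abs_sub _ _
      _ ≤ (m + 2).choose 2 * |z.im| ^ 2 * ‖z‖ ^ m * ‖z‖ +
            ((m + 1 : ℕ) + 1) * |z.im| * ‖z‖ ^ (m + 1) * |z.im| := by
          gcongr
          · exact Complex.abs_re_le_norm z
          · exact abs_im_pow_succ_le z (m + 1)
      _ = (m + 3).choose 2 * |z.im| ^ 2 * ‖z‖ ^ (m + 1) := by
          rw [Nat.choose_succ_succ' (m + 2) 1, Nat.choose_one_right]
          push_cast
          ring

lemma abs_im_pow_sub_le (m : ℕ) :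
    |(z ^ (m + 3)).im - (m + 3) * z.re ^ (m + 2) * z.im| ≤
      (m + 3).choose 3 * |z.im| ^ 3 * ‖z‖ ^ m := by
  induction m with
  | zero =>
    have h : (z ^ 3).im - 3 * z.re ^ 2 * z.im = -z.im ^ 3 := by
      simp [pow_succ]
      ring
    simp [h]
  | succ m ih =>
    have h1 : (z ^ (m + 4)).im - ((m + 1 : ℕ) + 3) * z.re ^ (m + 3) * z.im =
        ((z ^ (m + 3)).im - (m + 3) * z.re ^ (m + 2) * z.im) * z.re +
          ((z ^ (m + 3)).re - z.re ^ (m + 3)) * z.im := by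
      rw [pow_succ, Complex.mul_im]
      push_cast
      ring
    calc |(z ^ (m + 4)).im - ((m + 1 : ℕ) + 3) * z.re ^ (m + 3) * z.im|
        ≤ |(z ^ (m + 3)).im - (m + 3) * z.re ^ (m + 2) * z.im| * |z.re| +
            |(z ^ (m + 3)).re - z.re ^ (m + 3)| * |z.im| := by
          rw [h1, ← abs_mul, ← abs_mul]
          exact abs_add_le _ _
      _ ≤ (m + 3).choose 3 * |z.im| ^ 3 * ‖z‖ ^ m * ‖z‖ +
            (m + 3).choose 2 * |z.im| ^ 2 * ‖z‖ ^ (m + 1) * |z.im| := by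
          gcongr
          · exact Complex.abs_re_le_norm z
          · exact abs_re_pow_sub_le z (m + 1)
      _ = (m + 4).choose 3 * |z.im| ^ 3 * ‖z‖ ^ (m + 1) := by
          rw [Nat.choose_succ_succ' (m + 3) 2]
          push_cast
          ring

end PowerEstimates

/-- The sum of the squared moduli of the characteristic functions of the two dice, in terms of
`u = 1 - cos t`. -/
noncomputable def sqModSum (u : ℝ) : ℝ :=
  (72 - 732 * u + 2768 * u ^ 2 - 4440 * u ^ 3 + 3472 * u ^ 4 - 1312 * u ^ 5 + 192 * u ^ 6) / 36

lemma norm_roundCharFun_le (t : ℝ) : ‖roundCharFun t‖ ≤ |sqModSum (1 - Real.cos t) / 2| := by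
  set u := 1 - Real.cos t with hu
  have hs : Real.sin t ^ 2 = u * (2 - u) := by
    rw [Real.sin_sq, hu]
    ring
  refine (sq_le_sq₀ (norm_nonneg _) (abs_nonneg _)).1 ?_
  rw [sq_abs, Complex.sq_norm, Complex.normSq_apply]
  have h : (roundCharFun t).im * (roundCharFun t).im = u * (2 - u) * (u * imPoly u) ^ 2 := by
    rw [← hs, roundCharFun, ← hu]
    ring
  rw [h]
  simp only [roundCharFun, ← hu]
  have hdiff := sq_nonneg ((36 - 474 * u + 2104 * u ^ 2 - 3720 * u ^ 3 + 3120 * u ^ 4 -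
    1248 * u ^ 5 + 192 * u ^ 6) - (36 - 258 * u + 664 * u ^ 2 - 720 * u ^ 3 + 352 * u ^ 4 -
    64 * u ^ 5))
  unfold rePoly imPoly sqModSum
  linarith

section PolynomialBounds

variable {u : ℝ}

lemma sub_pow_mul_sub_pow_nonneg {a b : ℝ} (ha : a ≤ u) (hb : u ≤ b) (i j : ℕ) :
    0 ≤ (u - a) ^ i * (b - u) ^ j :=
  mul_nonneg (pow_nonneg (sub_nonneg.2 ha) i) (pow_nonneg (sub_nonneg.2 hb) j)

lemma one_sub_le_rePoly (h0 : 0 ≤ u) (h1 : u ≤ 1 / 10) : 1 - 51 / 5 * u ≤ rePoly u := by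
  have H := sub_pow_mul_sub_pow_nonneg h0 h1
  unfold rePoly
  linarith [H 0 6, H 1 5, H 2 4, H 3 3, H 4 2, H 5 1, H 6 0]

lemma rePoly_nonneg (h0 : 0 ≤ u) (h1 : u ≤ 1 / 10) : 0 ≤ rePoly u := by
  have H := sub_pow_mul_sub_pow_nonneg h0 h1
  unfold rePoly
  linarith [H 0 6, H 1 5, H 2 4, H 3 3, H 4 2, H 5 1, H 6 0]

lemma le_imPoly (h0 : 0 ≤ u) (h1 : u ≤ 1 / 10) : 1 / 6 ≤ imPoly u := by
  have H := sub_pow_mul_sub_pow_nonneg h0 h1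
  unfold imPoly
  linarith [H 0 4, H 1 3, H 2 2, H 3 1, H 4 0]

lemma imPoly_le (h0 : 0 ≤ u) (h1 : u ≤ 1 / 10) : imPoly u ≤ 1 / 5 := by
  have H := sub_pow_mul_sub_pow_nonneg h0 h1
  unfold imPoly
  linarith [H 0 4, H 1 3, H 2 2, H 3 1, H 4 0]

lemma abs_sqModSum_le_of_le (h0 : 0 ≤ u) (h1 : u ≤ 1 / 10) :
    |sqModSum u / 2| ≤ 1 - 6 * u := by
  have H := sub_pow_mul_sub_pow_nonneg h0 h1
  have h2 : 0 ≤ sqModSum u := by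
    unfold sqModSum
    linarith [H 0 6, H 1 5, H 2 4, H 3 3, H 4 2, H 5 1, H 6 0]
  rw [abs_of_nonneg (by positivity)]
  unfold sqModSum
  linarith [H 0 6, H 1 5, H 2 4, H 3 3, H 4 2, H 5 1, H 6 0]

lemma abs_sqModSum_le_half (h0 : 1 / 10 ≤ u) (h1 : u ≤ 2) : |sqModSum u / 2| ≤ 1 / 2 := by
  have key : ∀ a b, a ≤ u → u ≤ b → (a = 1 / 10 ∧ b = 7 / 10 ∨ a = 7 / 10 ∧ b = 4 / 3 ∨
      a = 4 / 3 ∧ b = 2) → |sqModSum u / 2| ≤ 1 / 2 := by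
    intro a b ha hb h
    have H := sub_pow_mul_sub_pow_nonneg ha hb
    unfold sqModSum
    rcases h with ⟨rfl, rfl⟩ | ⟨rfl, rfl⟩ | ⟨rfl, rfl⟩ <;> rw [abs_le] <;> constructor <;>
      linarith [H 0 6, H 1 5, H 2 4, H 3 3, H 4 2, H 5 1, H 6 0]
  rcases le_total u (7 / 10) with h | h
  · exact key _ _ h0 h (by simp)
  rcases le_total u (4 / 3) with h' | h'
  · exact key _ _ h h' (by simp)
  · exact key _ _ h' h1 (by simp)

end PolynomialBounds

lemma choose_mul_pow_mul_pow_le {x : ℝ} (h0 : 0 ≤ x) (h1 : x ≤ 1) (m : ℕ) :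
    (m + 3).choose 3 * (x ^ 4 * (1 - x) ^ m) ≤ 4 / (m + 4) := by
  have hx : 0 ≤ 1 - x := sub_nonneg.2 h1
  have h : (m + 4).choose 4 * (x ^ 4 * (1 - x) ^ m) ≤ 1 := by
    calc (m + 4).choose 4 * (x ^ 4 * (1 - x) ^ m)
        = x ^ 4 * (1 - x) ^ (m + 4 - 4) * (m + 4).choose 4 := by
          rw [Nat.add_sub_cancel]
          ring
      _ ≤ ∑ k ∈ range (m + 4 + 1), x ^ k * (1 - x) ^ (m + 4 - k) * (m + 4).choose k :=
          single_le_sum (f := fun k => x ^ k * (1 - x) ^ (m + 4 - k) * (m + 4).choose k)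
            (fun k _ => by positivity) (by simp)
      _ = 1 := by rw [← add_pow, add_sub_cancel, one_pow]
  have hc : ((m : ℝ) + 4) * (m + 3).choose 3 = (m + 4).choose 4 * 4 := by
    exact_mod_cast Nat.add_one_mul_choose_eq (m + 3) 3
  rw [le_div_iff₀ (by positivity)]
  calc (m + 3).choose 3 * (x ^ 4 * (1 - x) ^ m) * (m + 4)
      = (m + 4) * (m + 3).choose 3 * (x ^ 4 * (1 - x) ^ m) := by ring
    _ ≤ 4 := by
      rw [hc]
      linarith

lemma half_pow_le {m : ℕ} (hm : 29 ≤ m) :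
    (10 : ℝ) * (1 / 2) ^ (m + 3) ≤ 1 / 10000 / (m + 4) := by
  induction m, hm using Nat.le_induction with
  | base => norm_num
  | succ k hk ih =>
    have hk' : (29 : ℝ) ≤ k := by exact_mod_cast hk
    rw [le_div_iff₀ (by positivity)] at ih ⊢
    rw [show k + 1 + 3 = k + 3 + 1 from rfl, pow_succ]
    have h : (0 : ℝ) ≤ (1 / 2) ^ (k + 3) := by positivity
    push_cast
    nlinarith

section Integrand

variable {t : ℝ} {m : ℕ}

lemma neg_half_pow_le_sin_mul_im (hu : 1 / 10 ≤ 1 - Real.cos t) :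
    -(1 / 2) ^ (m + 3) ≤ Real.sin t * (roundCharFun t ^ (m + 3)).im := by
  refine (abs_le.1 ?_).1
  calc |Real.sin t * (roundCharFun t ^ (m + 3)).im|
      ≤ 1 * ‖roundCharFun t ^ (m + 3)‖ := by
        rw [abs_mul]
        gcongr
        · exact Real.abs_sin_le_one t
        · exact Complex.abs_im_le_norm _
    _ ≤ (1 / 2) ^ (m + 3) := by
        rw [one_mul, norm_pow]
        gcongr
        exact (norm_roundCharFun_le t).trans
          (abs_sqModSum_le_half hu (by linarith [Real.neg_one_le_cos t]))

lemma main_sub_error_le_sin_mul_im (hs : 0 ≤ Real.sin t) {u : ℝ} (hu : u = 1 - Real.cos t)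
    (hu1 : u ≤ 1 / 10) :
    u * ((m + 3) * rePoly u ^ (m + 2) * (u * (2 - u) * imPoly u) - 1 / 10000 / (m + 4)) ≤
      Real.sin t * (roundCharFun t ^ (m + 3)).im := by
  have hu0 : 0 ≤ u := by linarith [Real.cos_le_one t]
  have hV := imPoly_le hu0 hu1
  have hV0 : 0 ≤ imPoly u := le_trans (by norm_num) (le_imPoly hu0 hu1)
  have hs2 : Real.sin t ^ 2 = u * (2 - u) := by
    rw [Real.sin_sq, hu]
    ring
  have him : (roundCharFun t).im = Real.sin t * u * imPoly u := by rw [hu, roundCharFun]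
  have hre : (roundCharFun t).re = rePoly u := by rw [hu, roundCharFun]
  have him0 : 0 ≤ (roundCharFun t).im := by rw [him]; positivity
  have hn : ‖roundCharFun t‖ ≤ 1 - 6 * u :=
    (norm_roundCharFun_le t).trans (hu ▸ abs_sqModSum_le_of_le hu0 hu1)
  have h1 := (abs_le.1 (abs_im_pow_sub_le (roundCharFun t) m)).1
  rw [abs_of_nonneg him0, hre] at h1
  have h2 : Real.sin t * (roundCharFun t).im ^ 3 ≤ u * (4 / 125 * u ^ 4) := by
    calc Real.sin t * (roundCharFun t).im ^ 3
        = (Real.sin t ^ 2) ^ 2 * u ^ 3 * imPoly u ^ 3 := by rw [him]; ring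
      _ = u ^ 5 * (2 - u) ^ 2 * imPoly u ^ 3 := by rw [hs2]; ring
      _ ≤ u ^ 5 * 2 ^ 2 * (1 / 5) ^ 3 := by
        gcongr
        · linarith
        · linarith
      _ = u * (4 / 125 * u ^ 4) := by ring
  have h3 := choose_mul_pow_mul_pow_le (x := 6 * u) (by linarith) (by linarith) m
  have h4 : Real.sin t * ((m + 3).choose 3 * (roundCharFun t).im ^ 3 * ‖roundCharFun t‖ ^ m) ≤
      u * (1 / 10000 / (m + 4)) := by
    calc Real.sin t * ((m + 3).choose 3 * (roundCharFun t).im ^ 3 * ‖roundCharFun t‖ ^ m)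
        = (m + 3).choose 3 * (Real.sin t * (roundCharFun t).im ^ 3) * ‖roundCharFun t‖ ^ m := by
          ring
      _ ≤ (m + 3).choose 3 * (u * (4 / 125 * u ^ 4)) * (1 - 6 * u) ^ m := by gcongr
      _ = u * (1 / 40500 * ((m + 3).choose 3 * ((6 * u) ^ 4 * (1 - 6 * u) ^ m))) := by ring
      _ ≤ u * (1 / 40500 * (4 / (m + 4))) := by gcongr
      _ = u * (4 / 40500 / (m + 4)) := by ring
      _ ≤ u * (1 / 10000 / (m + 4)) := by
        gcongr u * (?_ / _)
        norm_num
  have h5 := mul_le_mul_of_nonneg_left h1 hs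
  have h6 : Real.sin t * (roundCharFun t).im = u * (u * (2 - u) * imPoly u) := by
    rw [him, ← hs2]
    ring
  linear_combination h5 + h4 - (m + 3) * rePoly u ^ (m + 2) * h6

lemma neg_le_advantage (hm : 29 ≤ m) (ht : t ∈ Set.Ioo 0 Real.pi) :
    -(36 ^ (m + 3) * (1 / 10000 / (m + 4))) ≤ advantage (m + 3) t := by
  have hs : 0 ≤ Real.sin t := (Real.sin_pos_of_mem_Ioo ht).le
  have hu0 : 0 < 1 - Real.cos t := by
    have := Real.cos_lt_cos_of_nonneg_of_le_pi le_rfl ht.2.le ht.1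
    rw [Real.cos_zero] at this
    linarith
  refine le_of_mul_le_mul_right ?_ hu0
  rw [advantage_mul_one_sub_cos, ← mul_neg, mul_assoc]
  refine mul_le_mul_of_nonneg_left ?_ (by positivity)
  rcases le_total (1 - Real.cos t) (1 / 10) with hu | hu
  · refine le_trans ?_ (main_sub_error_le_sin_mul_im hs rfl hu)
    have h1 := rePoly_nonneg hu0.le hu
    have h2 : 0 ≤ imPoly (1 - Real.cos t) := le_trans (by norm_num) (le_imPoly hu0.le hu)
    have h3 : 0 ≤ 2 - (1 - Real.cos t) := by linarith
    rw [mul_comm]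
    gcongr
    rw [neg_le_sub_iff_le_add]
    exact le_add_of_nonneg_left (by positivity)
  · refine le_trans ?_ (neg_half_pow_le_sin_mul_im hu)
    have h1 := half_pow_le hm
    have h2 : (0 : ℝ) ≤ 1 / 10000 / (m + 4) := by positivity
    nlinarith

lemma le_advantage (hm : 29 ≤ m) (ht : 0 < t) (h1 : 1 / 44 ≤ (m + 3) * t ^ 2)
    (h2 : (m + 3) * t ^ 2 ≤ 1 / 11) :
    36 ^ (m + 3) * (7 / 10000) ≤ advantage (m + 3) t := by
  have hm' : (29 : ℝ) ≤ m := by exact_mod_cast hm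
  have ht2 : t ^ 2 ≤ 1 / 300 := by nlinarith
  have ht1 : t ≤ 1 := by nlinarith
  have hpi := Real.pi_gt_three
  have hs : 0 ≤ Real.sin t := Real.sin_nonneg_of_nonneg_of_le_pi ht.le (by linarith)
  obtain ⟨u, hu⟩ : ∃ u, u = 1 - Real.cos t := ⟨_, rfl⟩
  have hu_le : u ≤ t ^ 2 / 2 := by linarith [Real.one_sub_sq_div_two_le_cos (x := t)]
  have hu_ge : t ^ 2 / 5 ≤ u := by
    have h := Real.cos_le_one_sub_mul_cos_sq (x := t) (by rw [abs_of_pos ht]; linarith)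
    have h5 : 1 / 5 ≤ 2 / Real.pi ^ 2 := by
      rw [div_le_div_iff₀ (by norm_num) (by positivity)]
      nlinarith [Real.pi_lt_d2]
    nlinarith [sq_nonneg t]
  have hu0 : 0 < u := lt_of_lt_of_le (by positivity) hu_ge
  have hu1 : u ≤ 1 / 10 := by linarith
  have hre : 1 / 2 ≤ rePoly u ^ (m + 2) := by
    calc (1 : ℝ) / 2 ≤ 1 + (m + 2 : ℕ) * (-(51 / 5 * u)) := by
          push_cast
          nlinarith
      _ ≤ (1 + -(51 / 5 * u)) ^ (m + 2) := one_add_mul_le_pow (by linarith) _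
      _ ≤ rePoly u ^ (m + 2) := by
          gcongr
          · linarith
          · linarith [one_sub_le_rePoly hu0.le hu1]
  have hV := le_imPoly hu0.le hu1
  refine le_of_mul_le_mul_right ?_ (hu ▸ hu0)
  rw [advantage_mul_one_sub_cos, mul_assoc]
  refine mul_le_mul_of_nonneg_left ?_ (by positivity)
  refine le_trans ?_ (main_sub_error_le_sin_mul_im hs hu hu1)
  rw [← hu, mul_comm]
  gcongr
  have herr : 1 / 10000 / ((m : ℝ) + 4) ≤ 1 / 10000 / 33 := by
    gcongr
    linarith
  have hmain : ((m : ℝ) + 3) * (1 / 2) * (t ^ 2 / 5 * (19 / 10) * (1 / 6)) ≤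
      (m + 3) * rePoly u ^ (m + 2) * (u * (2 - u) * imPoly u) := by
    have h2u : 19 / 10 ≤ 2 - u := by linarith
    have h2u0 : 0 ≤ u * (2 - u) := by nlinarith
    gcongr
  linarith

end Integrand

lemma integral_advantage_pos {m : ℕ} (hm : 29 ≤ m) :
    0 < ∫ t in (0 : ℝ)..Real.pi, advantage (m + 3) t := by
  have hm' : (29 : ℝ) ≤ m := by exact_mod_cast hm
  have hpi := Real.pi_gt_three
  have hpi' := Real.pi_lt_d2
  set τ : ℝ := √(1 / (11 * (m + 3))) with hτ
  have hτ0 : 0 < τ := by positivity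
  have hτ2 : (m + 3) * τ ^ 2 = 1 / 11 := by
    rw [hτ, Real.sq_sqrt (by positivity)]
    field_simp
  have hτ1 : τ ≤ 1 := by nlinarith
  have hτ_ge : 1 / ((m : ℝ) + 4) ≤ τ := by
    apply Real.le_sqrt_of_sq_le
    rw [div_pow, one_pow]
    apply one_div_le_one_div_of_le (by positivity)
    nlinarith
  have hint : ∀ a b, IntervalIntegrable (advantage (m + 3)) MeasureTheory.volume a b :=
    fun a b => (continuous_advantage _).intervalIntegrable a b
  set K : ℝ := 36 ^ (m + 3) * (1 / 10000 / (m + 4)) with hK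
  have hlow : ∀ a b, 0 ≤ a → a ≤ b → b ≤ Real.pi →
      -K * (b - a) ≤ ∫ t in a..b, advantage (m + 3) t := by
    intro a b ha hab hb
    calc -K * (b - a) = ∫ _ in a..b, -K := by simp [mul_comm]
      _ ≤ _ := intervalIntegral.integral_mono_on_of_le_Ioo hab (by simp) (hint a b) fun t ht =>
        neg_le_advantage hm ⟨ha.trans_lt ht.1, ht.2.trans_le hb⟩
  have hmid : 36 ^ (m + 3) * (7 / 10000) * (τ - τ / 2) ≤
      ∫ t in (τ / 2)..τ, advantage (m + 3) t := by
    calc 36 ^ (m + 3) * (7 / 10000) * (τ - τ / 2)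
        = ∫ _ in (τ / 2)..τ, (36 : ℝ) ^ (m + 3) * (7 / 10000) := by
          rw [intervalIntegral.integral_const, smul_eq_mul, mul_comm]
      _ ≤ _ := intervalIntegral.integral_mono_on (by linarith) (by simp) (hint _ _)
        fun t ht => le_advantage hm (by linarith [ht.1]) ?_ ?_
    · have : (τ / 2) ^ 2 ≤ t ^ 2 := by
        have := ht.1
        gcongr
      nlinarith
    · have : t ^ 2 ≤ τ ^ 2 := by
        have := ht.2
        have := ht.1
        gcongr
        linarith
      nlinarith
  rw [← intervalIntegral.integral_add_adjacent_intervals (hint 0 τ) (hint τ Real.pi),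
    ← intervalIntegral.integral_add_adjacent_intervals (hint 0 (τ / 2)) (hint (τ / 2) τ)]
  have hl := hlow 0 (τ / 2) le_rfl (by linarith) (by linarith)
  have hr := hlow τ Real.pi hτ0.le (by linarith) le_rfl
  have hcmp : K * 9 < 36 ^ (m + 3) * (7 / 10000) * τ * (9 / 7 + 1 / 100) := by
    calc K * 9 = 36 ^ (m + 3) * (7 / 10000) * (1 / (m + 4)) * (9 / 7) := by
          rw [hK]
          ring
      _ ≤ 36 ^ (m + 3) * (7 / 10000) * τ * (9 / 7) := by gcongr
      _ < _ := by
        gcongr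
        norm_num
  have hK0 : 0 < K := by positivity
  nlinarith

lemma goliath_beats_david_of_le {n : ℕ} (hn : 32 ≤ n) : Beats Goliath David n := by
  obtain ⟨m, rfl⟩ := Nat.exists_eq_add_of_le' (show 3 ≤ n by omega)
  rw [goliath_beats_david_iff]
  have h := integral_advantage_pos (m := m) (by omega)
  rw [integral_advantage, mul_pos_iff_of_pos_left Real.pi_pos, sub_pos] at h
  exact_mod_cast h

/-- For every `n` with `1 ≤ n ≤ 58116` and `n ≠ 4`, Goliath beats David after
`n` rolls, and David beats Goliath after `4` rolls. -/
theorem david_vs_goliath_upTo_58116 :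
    (∀ n : ℕ, 1 ≤ n → n ≤ 58116 → n ≠ 4 → Beats Goliath David n) ∧
      Beats David Goliath 4 := by
  refine ⟨fun n h1 _ h4 => ?_, david_beats_goliath_four⟩
  rcases lt_or_ge n 32 with hn | hn
  · exact goliath_beats_david_of_lt h1 h4 hn
  · exact goliath_beats_david_of_le hn
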